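/- arXiv:0807.2160 — 2 statements merged into one kernel-verified Lean document; each statement's English description precedes it below -/
import Mathlib

section
/- There exist constants C₁ > 0 and ε₀ > 0 such that for every positive integer N with ε = a/N ∈ (0, ε₀) and every continuously differentiable function u : ℝ² → ℝ vanishing on Γ_ε (i.e. u(x₁, −l) = 0 whenever (x₁,−l) lies on the base of one of the rods), the norms ‖u‖_ε = (∫_{Ω_ε} ‖∇u‖² dx)^{1/2} and ‖u‖_{H¹(Ω_ε)} = (∫_{Ω_ε} (‖∇u‖² + u²) dx)^{1/2} satisfy ‖u‖_ε ≤ ‖u‖_{H¹(Ω_ε)} ≤ C₁ ‖u‖_ε. -/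
open MeasureTheory

/-- Cauchy–Schwarz against the constant function `1` on an interval. -/
lemma sq_intervalIntegral_le {g : ℝ → ℝ} (hg : Continuous g) {a b : ℝ} (hab : a < b) :
    (∫ t in a..b, g t) ^ 2 ≤ (b - a) * ∫ t in a..b, g t ^ 2 := by
  set I := ∫ t in a..b, g t with hI
  have hba : 0 < b - a := sub_pos.2 hab
  have h0 : 0 ≤ ∫ t in a..b, (g t - I / (b - a)) ^ 2 :=
    intervalIntegral.integral_nonneg hab.le fun t _ => sq_nonneg _
  have h1 : ∫ t in a..b, (g t - I / (b - a)) ^ 2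
      = (∫ t in a..b, g t ^ 2) - 2 * (I / (b - a)) * I + (b - a) * (I / (b - a)) ^ 2 := by
    have : ∀ t, (g t - I / (b - a)) ^ 2
        = g t ^ 2 - 2 * (I / (b - a)) * g t + (I / (b - a)) ^ 2 := fun t => by ring
    simp only [this]
    rw [intervalIntegral.integral_add, intervalIntegral.integral_sub,
      intervalIntegral.integral_const_mul, intervalIntegral.integral_const, smul_eq_mul]
    all_goals exact Continuous.intervalIntegrable (by fun_prop) _ _
  rw [h1] at h0
  have h2 : (b - a) * ((∫ t in a..b, g t ^ 2) - 2 * (I / (b - a)) * I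
      + (b - a) * (I / (b - a)) ^ 2) = (b - a) * (∫ t in a..b, g t ^ 2) - I ^ 2 := by
    field_simp
    ring
  nlinarith [mul_nonneg hba.le h0]

/-- The oscillation of a `C¹` function on an interval is controlled by its Dirichlet energy. -/
lemma sq_sub_le_integral_sq {f f' g : ℝ → ℝ} (hf : ∀ t, HasDerivAt f (f' t) t)
    (hf' : Continuous f') (hg : Continuous g) (hfg : ∀ t, |f' t| ≤ g t)
    {a b : ℝ} (hab : a < b) {x s : ℝ} (hx : x ∈ Set.Icc a b) (hs : s ∈ Set.Icc a b) :
    (f x - f s) ^ 2 ≤ (b - a) * ∫ t in a..b, g t ^ 2 := by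
  have hFTC : ∫ t in s..x, f' t = f x - f s :=
    intervalIntegral.integral_eq_sub_of_hasDerivAt (fun t _ => hf t) (hf'.intervalIntegrable _ _)
  have habs : |f x - f s| ≤ ∫ t in a..b, g t := by
    rw [← hFTC]
    calc |∫ t in s..x, f' t| ≤ |(∫ t in s..x, |f' t|)| := by
          simpa only [Real.norm_eq_abs] using
            intervalIntegral.norm_integral_le_abs_integral_norm (f := f') (a := s) (b := x)
              (μ := volume)
      _ ≤ |(∫ t in a..b, |f' t|)| := by
          refine intervalIntegral.abs_integral_mono_interval ?_
            (Filter.Eventually.of_forall fun t => abs_nonneg _)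
            (hf'.abs.intervalIntegrable _ _)
          rw [Set.uIoc_of_le hab.le]
          intro t ht
          rw [Set.mem_uIoc] at ht
          constructor <;> rcases ht with ht | ht <;> linarith [hx.1, hx.2, hs.1, hs.2, ht.1, ht.2]
      _ = ∫ t in a..b, |f' t| :=
          abs_of_nonneg (intervalIntegral.integral_nonneg hab.le fun t _ => abs_nonneg _)
      _ ≤ ∫ t in a..b, g t :=
          intervalIntegral.integral_mono_on hab.le (hf'.abs.intervalIntegrable _ _)
            (hg.intervalIntegrable _ _) fun t _ => hfg t
  calc (f x - f s) ^ 2 = |f x - f s| ^ 2 := (sq_abs _).symm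
    _ ≤ (∫ t in a..b, g t) ^ 2 := pow_le_pow_left₀ (abs_nonneg _) habs 2
    _ ≤ _ := sq_intervalIntegral_le hg hab

lemma setLIntegral_Ioo_ofReal_sq {f : ℝ → ℝ} (hf : Continuous f) {a b : ℝ} (hab : a ≤ b) :
    ∫⁻ t in Set.Ioo a b, ENNReal.ofReal (f t ^ 2) = ENNReal.ofReal (∫ t in a..b, f t ^ 2) := by
  rw [intervalIntegral.integral_of_le hab, integral_Ioc_eq_integral_Ioo,
    ofReal_integral_eq_lintegral_ofReal]
  · exact ((hf.pow 2).integrableOn_Icc (a := a) (b := b)).mono_set Set.Ioo_subset_Icc_self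
  · exact Filter.Eventually.of_forall fun t => sq_nonneg _

/-- Friedrichs' inequality on an interval for functions vanishing at the left end. -/
lemma lintegral_sq_le_of_left_eq_zero {f f' g : ℝ → ℝ} (hf : ∀ t, HasDerivAt f (f' t) t)
    (hf' : Continuous f') (hg : Continuous g) (hfg : ∀ t, |f' t| ≤ g t)
    {a b : ℝ} (hab : a < b) (ha : f a = 0) :
    ∫⁻ t in Set.Ioo a b, ENNReal.ofReal (f t ^ 2) ≤
      ENNReal.ofReal ((b - a) ^ 2) * ∫⁻ t in Set.Ioo a b, ENNReal.ofReal (g t ^ 2) := by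
  have hfc : Continuous f := continuous_iff_continuousAt.2 fun t => (hf t).continuousAt
  rw [setLIntegral_Ioo_ofReal_sq hfc hab.le, setLIntegral_Ioo_ofReal_sq hg hab.le,
    ← ENNReal.ofReal_mul (sq_nonneg _)]
  refine ENNReal.ofReal_le_ofReal ?_
  calc ∫ t in a..b, f t ^ 2 ≤ ∫ _ in a..b, (b - a) * ∫ t in a..b, g t ^ 2 := by
        refine intervalIntegral.integral_mono_on hab.le
          ((hfc.pow 2).intervalIntegrable _ _) (continuous_const.intervalIntegrable _ _) ?_
        intro t ht
        simpa [ha] using sq_sub_le_integral_sq hf hf' hg hfg hab ht (Set.left_mem_Icc.2 hab.le)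
    _ = _ := by
        rw [intervalIntegral.integral_const, smul_eq_mul]
        ring

/-- The `L²` norm on an interval is controlled by the `L²` norm on a subinterval and the
Dirichlet energy. -/
lemma lintegral_sq_le_subinterval {f f' g : ℝ → ℝ} (hf : ∀ t, HasDerivAt f (f' t) t)
    (hf' : Continuous f') (hg : Continuous g) (hfg : ∀ t, |f' t| ≤ g t)
    {a b c d : ℝ} (hac : a ≤ c) (hcd : c < d) (hdb : d ≤ b) :
    ∫⁻ t in Set.Ioo a b, ENNReal.ofReal (f t ^ 2) ≤
      ENNReal.ofReal (2 * (b - a) / (d - c)) * (∫⁻ t in Set.Ioo c d, ENNReal.ofReal (f t ^ 2)) +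
      ENNReal.ofReal (2 * (b - a) ^ 2) * ∫⁻ t in Set.Ioo a b, ENNReal.ofReal (g t ^ 2) := by
  have hfc : Continuous f := continuous_iff_continuousAt.2 fun t => (hf t).continuousAt
  have hab : a < b := by linarith
  have hba : 0 < b - a := sub_pos.2 hab
  have hdc : 0 < d - c := sub_pos.2 hcd
  have hF : 0 ≤ ∫ t in c..d, f t ^ 2 :=
    intervalIntegral.integral_nonneg hcd.le fun t _ => sq_nonneg _
  have hG : 0 ≤ ∫ t in a..b, g t ^ 2 :=
    intervalIntegral.integral_nonneg hab.le fun t _ => sq_nonneg _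
  rw [setLIntegral_Ioo_ofReal_sq hfc hab.le, setLIntegral_Ioo_ofReal_sq hg hab.le,
    setLIntegral_Ioo_ofReal_sq hfc hcd.le, ← ENNReal.ofReal_mul (by positivity),
    ← ENNReal.ofReal_mul (by positivity), ← ENNReal.ofReal_add (by positivity) (by positivity)]
  refine ENNReal.ofReal_le_ofReal ?_
  set F := ∫ t in c..d, f t ^ 2 with hFdef
  set G := ∫ t in a..b, g t ^ 2 with hGdef
  have hpt : ∀ x ∈ Set.Icc a b, f x ^ 2 ≤ 2 / (d - c) * F + 2 * (b - a) * G := by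
    intro x hx
    have h1 : ∫ _ in c..d, f x ^ 2 ≤ ∫ s in c..d, (2 * f s ^ 2 + 2 * ((b - a) * G)) := by
      refine intervalIntegral.integral_mono_on hcd.le (continuous_const.intervalIntegrable _ _)
        (Continuous.intervalIntegrable (by fun_prop) _ _) ?_
      intro s hs
      have := sq_sub_le_integral_sq hf hf' hg hfg hab hx
        (s := s) ⟨hac.trans hs.1, hs.2.trans hdb⟩
      nlinarith [sq_nonneg (f x - 2 * f s)]
    rw [intervalIntegral.integral_add (Continuous.intervalIntegrable (by fun_prop) _ _)
      (Continuous.intervalIntegrable (by fun_prop) _ _), intervalIntegral.integral_const_mul,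
      intervalIntegral.integral_const, intervalIntegral.integral_const, smul_eq_mul,
      smul_eq_mul, ← hFdef] at h1
    have h2 : 2 / (d - c) * F + 2 * (b - a) * G
        = (2 * F + (d - c) * (2 * ((b - a) * G))) / (d - c) := by
      field_simp
    rw [h2, le_div_iff₀ hdc]
    linarith
  calc ∫ t in a..b, f t ^ 2 ≤ ∫ _ in a..b, (2 / (d - c) * F + 2 * (b - a) * G) :=
        intervalIntegral.integral_mono_on hab.le
          ((hfc.pow 2).intervalIntegrable _ _) (continuous_const.intervalIntegrable _ _) hpt
    _ = _ := by
        rw [intervalIntegral.integral_const, smul_eq_mul]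
        ring

/-- An inequality between integrals over adjacent intervals adds up to their union. -/
lemma setLIntegral_Ico_le_of_adjacent {F G : ℝ → ENNReal} {c : ℕ → ℝ} (hc : Monotone c) (n : ℕ)
    (hFG : ∀ j < n, ∫⁻ t in Set.Ico (c j) (c (j + 1)), F t ≤
      ∫⁻ t in Set.Ico (c j) (c (j + 1)), G t) :
    ∫⁻ t in Set.Ico (c 0) (c n), F t ≤ ∫⁻ t in Set.Ico (c 0) (c n), G t := by
  induction n with
  | zero => simp
  | succ n ih =>
    have hd : Disjoint (Set.Ico (c 0) (c n)) (Set.Ico (c n) (c (n + 1))) :=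
      Set.disjoint_left.2 fun t h1 h2 => absurd h1.2 (not_lt.2 h2.1)
    rw [← Set.Ico_union_Ico_eq_Ico (hc (Nat.zero_le n)) (hc (Nat.le_succ n)),
      lintegral_union measurableSet_Ico hd, lintegral_union measurableSet_Ico hd]
    exact add_le_add (ih fun j hj => hFG j (hj.trans (Nat.lt_succ_self n)))
      (hFG n (Nat.lt_succ_self n))

lemma setLIntegral_eq_lintegral_slices {S : Set (ℝ × ℝ)} (hS : MeasurableSet S)
    {f : ℝ × ℝ → ENNReal} (hf : Measurable f) :
    ∫⁻ z in S, f z = ∫⁻ x, ∫⁻ y in {y | (x, y) ∈ S}, f (x, y) := by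
  rw [← lintegral_indicator hS, Measure.volume_eq_prod,
    lintegral_prod _ (hf.indicator hS).aemeasurable]
  refine lintegral_congr fun x => ?_
  rw [← lintegral_indicator (s := {y | (x, y) ∈ S}) (measurable_prodMk_left hS)]
  rfl

lemma setLIntegral_eq_lintegral_slices_symm {S : Set (ℝ × ℝ)} (hS : MeasurableSet S)
    {f : ℝ × ℝ → ENNReal} (hf : Measurable f) :
    ∫⁻ z in S, f z = ∫⁻ y, ∫⁻ x in {x | (x, y) ∈ S}, f (x, y) := by
  rw [← lintegral_indicator hS, Measure.volume_eq_prod,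
    lintegral_prod_symm _ (hf.indicator hS).aemeasurable]
  refine lintegral_congr fun y => ?_
  rw [← lintegral_indicator (s := {x | (x, y) ∈ S}) (measurable_prodMk_right hS)]
  rfl

lemma measurable_setLIntegral_slice {S : Set (ℝ × ℝ)} (hS : MeasurableSet S)
    {f : ℝ × ℝ → ENNReal} (hf : Measurable f) :
    Measurable fun x => ∫⁻ y in {y | (x, y) ∈ S}, f (x, y) := by
  have h := (hf.indicator hS).lintegral_prod_right' (ν := (volume : Measure ℝ))
  convert h using 2 with x
  rw [← lintegral_indicator (s := {y | (x, y) ∈ S}) (measurable_prodMk_left hS)]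
  rfl

lemma measurable_setLIntegral_slice_symm {S : Set (ℝ × ℝ)} (hS : MeasurableSet S)
    {f : ℝ × ℝ → ENNReal} (hf : Measurable f) :
    Measurable fun y => ∫⁻ x in {x | (x, y) ∈ S}, f (x, y) := by
  have h := (hf.indicator hS).lintegral_prod_left' (μ := (volume : Measure ℝ))
  convert h using 2 with y
  rw [← lintegral_indicator (s := {x | (x, y) ∈ S}) (measurable_prodMk_right hS)]
  rfl

/-- Integral inequalities along vertical lines integrate to planar ones. -/
lemma setLIntegral_le_of_vertical_slices {S R Q : Set (ℝ × ℝ)} (hS : MeasurableSet S)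
    (hR : MeasurableSet R) (hQ : MeasurableSet Q) {f g : ℝ × ℝ → ENNReal} (hf : Measurable f)
    (hg : Measurable g) (A B : ENNReal)
    (H : ∀ x, ∫⁻ y in {y | (x, y) ∈ S}, f (x, y) ≤
      A * (∫⁻ y in {y | (x, y) ∈ R}, f (x, y)) + B * ∫⁻ y in {y | (x, y) ∈ Q}, g (x, y)) :
    ∫⁻ z in S, f z ≤ A * (∫⁻ z in R, f z) + B * ∫⁻ z in Q, g z := by
  rw [setLIntegral_eq_lintegral_slices hS hf, setLIntegral_eq_lintegral_slices hR hf,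
    setLIntegral_eq_lintegral_slices hQ hg,
    ← lintegral_const_mul _ (measurable_setLIntegral_slice hR hf),
    ← lintegral_const_mul _ (measurable_setLIntegral_slice hQ hg),
    ← lintegral_add_left ((measurable_setLIntegral_slice hR hf).const_mul A)]
  exact lintegral_mono H

/-- Integral inequalities along horizontal lines integrate to planar ones. -/
lemma setLIntegral_le_of_horizontal_slices {S R Q : Set (ℝ × ℝ)} (hS : MeasurableSet S)
    (hR : MeasurableSet R) (hQ : MeasurableSet Q) {f g : ℝ × ℝ → ENNReal} (hf : Measurable f)
    (hg : Measurable g) (A B : ENNReal)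
    (H : ∀ y, ∫⁻ x in {x | (x, y) ∈ S}, f (x, y) ≤
      A * (∫⁻ x in {x | (x, y) ∈ R}, f (x, y)) + B * ∫⁻ x in {x | (x, y) ∈ Q}, g (x, y)) :
    ∫⁻ z in S, f z ≤ A * (∫⁻ z in R, f z) + B * ∫⁻ z in Q, g z := by
  rw [setLIntegral_eq_lintegral_slices_symm hS hf, setLIntegral_eq_lintegral_slices_symm hR hf,
    setLIntegral_eq_lintegral_slices_symm hQ hg,
    ← lintegral_const_mul _ (measurable_setLIntegral_slice_symm hR hf),
    ← lintegral_const_mul _ (measurable_setLIntegral_slice_symm hQ hg),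
    ← lintegral_add_left ((measurable_setLIntegral_slice_symm hR hf).const_mul A)]
  exact lintegral_mono H

lemma hasDerivAt_vertical {u : ℝ × ℝ → ℝ} (hu : ContDiff ℝ 1 u) (x y : ℝ) :
    HasDerivAt (fun t => u (x, t)) (fderiv ℝ u (x, y) (0, 1)) y :=
  ((hu.differentiable one_ne_zero) (x, y)).hasFDerivAt.comp_hasDerivAt y
    ((hasDerivAt_const y x).prodMk (hasDerivAt_id y))

lemma hasDerivAt_horizontal {u : ℝ × ℝ → ℝ} (hu : ContDiff ℝ 1 u) (x y : ℝ) :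
    HasDerivAt (fun t => u (t, y)) (fderiv ℝ u (x, y) (1, 0)) x :=
  ((hu.differentiable one_ne_zero) (x, y)).hasFDerivAt.comp_hasDerivAt x
    ((hasDerivAt_id x).prodMk (hasDerivAt_const x y))

lemma abs_clm_vertical_le (L : ℝ × ℝ →L[ℝ] ℝ) : |L (0, 1)| ≤ ‖L‖ := by
  simpa using L.le_opNorm (0, 1)

lemma abs_clm_horizontal_le (L : ℝ × ℝ →L[ℝ] ℝ) : |L (1, 0)| ≤ ‖L‖ := by
  simpa using L.le_opNorm (1, 0)

/-- Friedrichs' inequality on a union of vertical strips whose bases carry a zero condition. -/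
lemma lintegral_sq_le_of_eq_zero_on_base {u : ℝ × ℝ → ℝ} (hu : ContDiff ℝ 1 u) {T : Set ℝ}
    (hT : MeasurableSet T) {p q : ℝ} (hpq : p < q) (h0 : ∀ x ∈ T, u (x, p) = 0) :
    ∫⁻ z in T ×ˢ Set.Ioo p q, ENNReal.ofReal (u z ^ 2) ≤
      ENNReal.ofReal ((q - p) ^ 2) *
        ∫⁻ z in T ×ˢ Set.Ioo p q, ENNReal.ofReal (‖fderiv ℝ u z‖ ^ 2) := by
  have hu' : Continuous (fderiv ℝ u) := hu.continuous_fderiv one_ne_zero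
  have huc := hu.continuous
  have hS : MeasurableSet (T ×ˢ Set.Ioo p q) := hT.prod measurableSet_Ioo
  have key := setLIntegral_le_of_vertical_slices hS hS hS
    (f := fun z => ENNReal.ofReal (u z ^ 2)) (g := fun z => ENNReal.ofReal (‖fderiv ℝ u z‖ ^ 2))
    (by fun_prop) (by fun_prop) 0 (ENNReal.ofReal ((q - p) ^ 2)) ?_
  · simpa only [zero_mul, zero_add] using key
  intro x
  rw [zero_mul, zero_add]
  by_cases hx : x ∈ T
  · have : {y | (x, y) ∈ T ×ˢ Set.Ioo p q} = Set.Ioo p q := by ext y; simp [hx]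
    rw [this]
    exact lintegral_sq_le_of_left_eq_zero (f := fun y => u (x, y))
      (g := fun y => ‖fderiv ℝ u (x, y)‖) (hasDerivAt_vertical hu x) (by fun_prop) (by fun_prop)
      (fun t => abs_clm_vertical_le _) hpq (h0 x hx)
  · have : {y | (x, y) ∈ T ×ˢ Set.Ioo p q} = ∅ := by ext y; simp [hx]
    rw [this, Measure.restrict_empty, lintegral_zero_measure]
    exact zero_le

/-- In a rectangle the `L²` norm is controlled by the `L²` norm on a periodic family of strips,
with a constant independent of the period, and the Dirichlet energy. -/
lemma lintegral_sq_le_of_periodic_strips {u : ℝ × ℝ → ℝ} (hu : ContDiff ℝ 1 u) {T : Set ℝ}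
    (hT : MeasurableSet T) {N : ℕ} {ε h : ℝ} (hε : 0 < ε) (hh : h ∈ Set.Ioo (0 : ℝ) 1)
    (hTsub : ∀ j < N, Set.Ioo (ε * (j + (1 - h) / 2)) (ε * (j + (1 + h) / 2)) ⊆ T) (m : ℝ) :
    ∫⁻ z in Set.Ioo 0 (ε * N) ×ˢ Set.Ioo 0 m, ENNReal.ofReal (u z ^ 2) ≤
      ENNReal.ofReal (2 / h) * (∫⁻ z in T ×ˢ Set.Ioo 0 m, ENNReal.ofReal (u z ^ 2)) +
      ENNReal.ofReal (2 * ε ^ 2) * ∫⁻ z in Set.Ioo 0 (ε * N) ×ˢ Set.Ioo 0 m,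
        ENNReal.ofReal (‖fderiv ℝ u z‖ ^ 2) := by
  have hu' : Continuous (fderiv ℝ u) := hu.continuous_fderiv one_ne_zero
  have huc := hu.continuous
  obtain ⟨hh0, hh1⟩ := hh
  have hS : MeasurableSet (Set.Ioo 0 (ε * N) ×ˢ Set.Ioo 0 m) :=
    measurableSet_Ioo.prod measurableSet_Ioo
  refine setLIntegral_le_of_horizontal_slices hS (hT.prod measurableSet_Ioo) hS
    (f := fun z => ENNReal.ofReal (u z ^ 2)) (g := fun z => ENNReal.ofReal (‖fderiv ℝ u z‖ ^ 2))
    (by fun_prop) (by fun_prop) _ _ ?_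
  intro y
  by_cases hy : y ∈ Set.Ioo 0 m
  swap
  · have : {x | (x, y) ∈ Set.Ioo 0 (ε * N) ×ˢ Set.Ioo 0 m} = ∅ := by
      ext x
      simp only [Set.mem_ofPred_eq, Set.mem_prod, hy, and_false, Set.mem_empty_iff_false]
    rw [this, Measure.restrict_empty, lintegral_zero_measure]
    exact zero_le
  have h1 : {x | (x, y) ∈ Set.Ioo 0 (ε * N) ×ˢ Set.Ioo 0 m} = Set.Ioo 0 (ε * N) := by
    ext x
    simp only [Set.mem_ofPred_eq, Set.mem_prod, hy, and_true]
  have h2 : {x | (x, y) ∈ T ×ˢ Set.Ioo 0 m} = T := by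
    ext x
    simp only [Set.mem_ofPred_eq, Set.mem_prod, hy, and_true]
  rw [h1, h2]
  set F : ℝ → ENNReal := fun x => ENNReal.ofReal (u (x, y) ^ 2) with hF
  set D : ℝ → ENNReal := fun x => ENNReal.ofReal (‖fderiv ℝ u (x, y)‖ ^ 2) with hD
  have hFm : Measurable F := by fun_prop
  have hDm : Measurable D := by fun_prop
  have hTF : Measurable (T.indicator F) := hFm.indicator hT
  have hsplit : ∀ S : Set ℝ, ∫⁻ x in S, (ENNReal.ofReal (2 / h) * T.indicator F x +
      ENNReal.ofReal (2 * ε ^ 2) * D x) = ENNReal.ofReal (2 / h) * (∫⁻ x in S, T.indicator F x) +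
      ENNReal.ofReal (2 * ε ^ 2) * ∫⁻ x in S, D x := by
    intro S
    rw [lintegral_add_left (hTF.const_mul _), lintegral_const_mul _ hTF,
      lintegral_const_mul _ hDm]
  have hmono : Monotone fun n : ℕ => ε * (n : ℝ) := fun i j hij =>
    mul_le_mul_of_nonneg_left (Nat.cast_le.2 hij) hε.le
  have key := setLIntegral_Ico_le_of_adjacent (F := F) (G := fun x =>
    ENNReal.ofReal (2 / h) * T.indicator F x + ENNReal.ofReal (2 * ε ^ 2) * D x) hmono N ?_
  · rw [hsplit] at key
    simp only [Nat.cast_zero, mul_zero, ← setLIntegral_congr (Ioo_ae_eq_Ico (μ := volume))]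
      at key
    refine key.trans (add_le_add (mul_le_mul_right ?_ _) le_rfl)
    rw [← lintegral_indicator hT]
    exact setLIntegral_le_lintegral _ _
  intro j hj
  rw [hsplit]
  simp only [← setLIntegral_congr (Ioo_ae_eq_Ico (μ := volume))]
  have hcell := lintegral_sq_le_subinterval (f := fun x => u (x, y))
    (g := fun x => ‖fderiv ℝ u (x, y)‖) (hasDerivAt_horizontal hu · y) (by fun_prop)
    (by fun_prop) (fun t => abs_clm_horizontal_le _)
    (a := ε * j) (b := ε * (j + 1 : ℕ)) (c := ε * (j + (1 - h) / 2))
    (d := ε * (j + (1 + h) / 2)) (by nlinarith) (by nlinarith) (by push_cast; nlinarith)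
  have e1 : ε * ((j + 1 : ℕ) : ℝ) - ε * j = ε := by push_cast; ring
  have e2 : ε * ((j : ℝ) + (1 + h) / 2) - ε * (j + (1 - h) / 2) = ε * h := by ring
  have e3 : 2 * ε / (ε * h) = 2 / h := by field_simp
  rw [e1, e2, e3] at hcell
  refine hcell.trans (add_le_add (mul_le_mul_right ?_ _) le_rfl)
  calc ∫⁻ x in Set.Ioo (ε * (j + (1 - h) / 2)) (ε * (j + (1 + h) / 2)), F x
      = ∫⁻ x in Set.Ioo (ε * (j + (1 - h) / 2)) (ε * (j + (1 + h) / 2)), T.indicator F x :=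
        setLIntegral_congr_fun measurableSet_Ioo fun x hx =>
          (Set.indicator_of_mem (hTsub j hj hx) F).symm
    _ ≤ _ := lintegral_mono_set (Set.Ioo_subset_Ioo (by nlinarith) (by push_cast; nlinarith))

/-- In a subgraph the `L²` norm is controlled by the `L²` norm on a bottom rectangle and the
Dirichlet energy. -/
lemma lintegral_sq_le_of_subgraph {u : ℝ × ℝ → ℝ} (hu : ContDiff ℝ 1 u) {a m M : ℝ}
    {γ : ℝ → ℝ} (hm : 0 < m) (hγm : ∀ x ∈ Set.Ioo 0 a, m ≤ γ x) (hγM : ∀ x ∈ Set.Ioo 0 a, γ x ≤ M)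
    {Ω₀ : Set (ℝ × ℝ)} (hΩ : Ω₀ = {x : ℝ × ℝ | 0 < x.1 ∧ x.1 < a ∧ 0 < x.2 ∧ x.2 < γ x.1})
    (hΩm : MeasurableSet Ω₀) :
    ∫⁻ z in Ω₀, ENNReal.ofReal (u z ^ 2) ≤
      ENNReal.ofReal (2 * M / m) *
        (∫⁻ z in Set.Ioo 0 a ×ˢ Set.Ioo 0 m, ENNReal.ofReal (u z ^ 2)) +
      ENNReal.ofReal (2 * M ^ 2) * ∫⁻ z in Ω₀, ENNReal.ofReal (‖fderiv ℝ u z‖ ^ 2) := by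
  have hu' : Continuous (fderiv ℝ u) := hu.continuous_fderiv one_ne_zero
  have huc := hu.continuous
  refine setLIntegral_le_of_vertical_slices hΩm (measurableSet_Ioo.prod measurableSet_Ioo) hΩm
    (f := fun z => ENNReal.ofReal (u z ^ 2)) (g := fun z => ENNReal.ofReal (‖fderiv ℝ u z‖ ^ 2))
    (by fun_prop) (by fun_prop) _ _ ?_
  intro x
  by_cases hx : x ∈ Set.Ioo 0 a
  swap
  · have : {y | (x, y) ∈ Ω₀} = ∅ := by
      ext y
      simp only [hΩ, Set.mem_ofPred_eq, Set.mem_empty_iff_false, iff_false]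
      exact fun hxy => hx ⟨hxy.1, hxy.2.1⟩
    rw [this, Measure.restrict_empty, lintegral_zero_measure]
    exact zero_le
  have h1 : {y | (x, y) ∈ Ω₀} = Set.Ioo 0 (γ x) := by
    ext y
    simp [hΩ, hx.1, hx.2]
  have h2 : {y | (x, y) ∈ Set.Ioo 0 a ×ˢ Set.Ioo 0 m} = Set.Ioo 0 m := by
    ext y
    simp [hx.1, hx.2]
  rw [h1, h2]
  have hγx := hγm x hx
  have hγx' := hγM x hx
  refine (lintegral_sq_le_subinterval (f := fun y => u (x, y))
    (g := fun y => ‖fderiv ℝ u (x, y)‖) (hasDerivAt_vertical hu x) (by fun_prop)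
    (by fun_prop) (fun t => abs_clm_vertical_le _) (a := 0) (b := γ x) (c := 0) (d := m)
    le_rfl hm hγx).trans ?_
  rw [sub_zero, sub_zero]
  gcongr
  linarith

/-- A uniform Poincaré inequality on a set that contains a subgraph and, up to a segment,
a periodic family of strips with a zero condition on their bases. -/
lemma lintegral_sq_le_thick_junction {u : ℝ × ℝ → ℝ} (hu : ContDiff ℝ 1 u)
    {a l h m M ε : ℝ} {N : ℕ} (hl : 0 < l) (hh : h ∈ Set.Ioo (0 : ℝ) 1) (hm : 0 < m)
    (hε : 0 < ε) (hεa : ε ≤ a) (hεN : ε * N = a) {γ : ℝ → ℝ}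
    (hγm : ∀ x ∈ Set.Ioo 0 a, m ≤ γ x) (hγM : ∀ x ∈ Set.Ioo 0 a, γ x ≤ M)
    {Ω₀ : Set (ℝ × ℝ)} (hΩ : Ω₀ = {x : ℝ × ℝ | 0 < x.1 ∧ x.1 < a ∧ 0 < x.2 ∧ x.2 < γ x.1})
    (hΩm : MeasurableSet Ω₀) {T : Set ℝ} (hT : MeasurableSet T) (hTa : T ⊆ Set.Ioo 0 a)
    (hTsub : ∀ j < N, Set.Ioo (ε * (j + (1 - h) / 2)) (ε * (j + (1 + h) / 2)) ⊆ T)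
    (h0 : ∀ x ∈ T, u (x, -l) = 0) :
    ∫⁻ z in Ω₀ ∪ T ×ˢ Set.Ioo (-l) 0, ENNReal.ofReal (u z ^ 2) ≤
      (ENNReal.ofReal (2 * M / m) * (ENNReal.ofReal (2 / h) * ENNReal.ofReal ((m + l) ^ 2) +
        ENNReal.ofReal (2 * a ^ 2)) + ENNReal.ofReal (2 * M ^ 2) +
        ENNReal.ofReal ((m + l) ^ 2)) *
      ∫⁻ z in Ω₀ ∪ T ×ˢ Set.Ioo (-l) 0, ENNReal.ofReal (‖fderiv ℝ u z‖ ^ 2) := by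
  set F : ℝ × ℝ → ENNReal := fun z => ENNReal.ofReal (u z ^ 2)
  set G : ℝ × ℝ → ENNReal := fun z => ENNReal.ofReal (‖fderiv ℝ u z‖ ^ 2)
  set D := ∫⁻ z in Ω₀ ∪ T ×ˢ Set.Ioo (-l) 0, G z
  have hrect : Set.Ioo 0 a ×ˢ Set.Ioo 0 m ⊆ Ω₀ := by
    rintro ⟨x, y⟩ ⟨hx, hy⟩
    rw [hΩ]
    exact ⟨hx.1, hx.2, hy.1, hy.2.trans_le (hγm x hx)⟩
  have hnull : volume (Set.univ ×ˢ {0} : Set (ℝ × ℝ)) = 0 := by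
    rw [Measure.volume_eq_prod, Measure.prod_prod]
    simp
  have hstripG : ∫⁻ z in T ×ˢ Set.Ioo (-l) m, G z ≤ D := by
    calc ∫⁻ z in T ×ˢ Set.Ioo (-l) m, G z
        ≤ ∫⁻ z in (Ω₀ ∪ T ×ˢ Set.Ioo (-l) 0) ∪ Set.univ ×ˢ {0}, G z := by
          refine lintegral_mono_set ?_
          rintro ⟨x, y⟩ ⟨hx, hy⟩
          rcases lt_trichotomy y 0 with hy0 | hy0 | hy0
          · exact Or.inl (Or.inr ⟨hx, hy.1, hy0⟩)
          · exact Or.inr ⟨trivial, hy0⟩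
          · exact Or.inl (Or.inl (hrect ⟨hTa hx, hy0, hy.2⟩))
      _ ≤ D + ∫⁻ z in Set.univ ×ˢ {0}, G z := lintegral_union_le _ _ _
      _ = D := by rw [setLIntegral_measure_zero _ _ hnull, add_zero]
  have hΩG : ∫⁻ z in Ω₀, G z ≤ D := lintegral_mono_set Set.subset_union_left
  have hstrip : ∫⁻ z in T ×ˢ Set.Ioo (-l) m, F z ≤ ENNReal.ofReal ((m + l) ^ 2) * D := by
    have := lintegral_sq_le_of_eq_zero_on_base hu hT (p := -l) (q := m) (by linarith) h0
    rw [sub_neg_eq_add] at this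
    exact this.trans (mul_le_mul_right hstripG _)
  have hrectF : ∫⁻ z in Set.Ioo 0 a ×ˢ Set.Ioo 0 m, F z ≤
      ENNReal.ofReal (2 / h) * (ENNReal.ofReal ((m + l) ^ 2) * D) +
        ENNReal.ofReal (2 * a ^ 2) * D := by
    have := lintegral_sq_le_of_periodic_strips hu hT hε hh hTsub m
    rw [hεN] at this
    refine this.trans (add_le_add (mul_le_mul_right (le_trans ?_ hstrip) _)
      (mul_le_mul' (ENNReal.ofReal_le_ofReal (by nlinarith))
        ((lintegral_mono_set hrect).trans hΩG)))
    exact lintegral_mono_set (Set.prod_mono le_rfl (Set.Ioo_subset_Ioo (by linarith) le_rfl))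
  have hΩF : ∫⁻ z in Ω₀, F z ≤ ENNReal.ofReal (2 * M / m) *
      (ENNReal.ofReal (2 / h) * (ENNReal.ofReal ((m + l) ^ 2) * D) +
        ENNReal.ofReal (2 * a ^ 2) * D) + ENNReal.ofReal (2 * M ^ 2) * D :=
    (lintegral_sq_le_of_subgraph hu hm hγm hγM hΩ hΩm).trans
      (add_le_add (mul_le_mul_right hrectF _) (mul_le_mul_right hΩG _))
  calc ∫⁻ z in Ω₀ ∪ T ×ˢ Set.Ioo (-l) 0, F z
      ≤ (∫⁻ z in Ω₀, F z) + ∫⁻ z in T ×ˢ Set.Ioo (-l) 0, F z := lintegral_union_le _ _ _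
    _ ≤ _ := add_le_add hΩF (le_trans (lintegral_mono_set
        (Set.prod_mono le_rfl (Set.Ioo_subset_Ioo le_rfl hm.le))) hstrip)
    _ = _ := by ring

lemma measurableSet_subgraph_Ioo {a : ℝ} {γ : ℝ → ℝ} (hγ : ContinuousOn γ (Set.Icc 0 a)) :
    MeasurableSet {x : ℝ × ℝ | 0 < x.1 ∧ x.1 < a ∧ 0 < x.2 ∧ x.2 < γ x.1} := by
  have hc : ContinuousOn (fun x : ℝ × ℝ => γ x.1 - x.2) (Set.Ioo 0 a ×ˢ Set.Ioi 0) :=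
    (hγ.comp continuous_fst.continuousOn fun x hx => Set.Ioo_subset_Icc_self hx.1).sub
      continuous_snd.continuousOn
  have := (hc.isOpen_inter_preimage (isOpen_Ioo.prod isOpen_Ioi) isOpen_Ioi
    (t := Set.Ioi (0 : ℝ))).measurableSet
  convert this using 1
  ext x
  simp only [Set.mem_ofPred_eq, Set.mem_inter_iff, Set.mem_prod, Set.mem_Ioo, Set.mem_Ioi,
    Set.mem_preimage, sub_pos]
  tauto

/-- Uniform equivalence of the Dirichlet norm `‖u‖_ε` and the full `H¹` norm on the thick
junction `Ω_ε`, for functions vanishing on the bases `Γ_ε` of the thin rods, with constants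
independent of `ε = a/N`. -/
theorem signorini_uniform_norm_equivalence
    (a l h : ℝ) (ha : 0 < a) (hl : 0 < l) (hh : h ∈ Set.Ioo (0 : ℝ) 1)
    (γ : ℝ → ℝ) (hγ : ContDiffOn ℝ 1 γ (Set.Icc 0 a))
    (hγpos : ∀ x₁ ∈ Set.Icc (0 : ℝ) a, 0 < γ x₁)
    (Ω₀ : Set (ℝ × ℝ))
    (hΩ₀ : Ω₀ = {x : ℝ × ℝ | 0 < x.1 ∧ x.1 < a ∧ 0 < x.2 ∧ x.2 < γ x.1}) :
    ∃ C₁ : ℝ, 0 < C₁ ∧ ∃ ε₀ : ℝ, 0 < ε₀ ∧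
      ∀ (N : ℕ), 0 < N →
        ∀ ε : ℝ, ε = a / N → ε < ε₀ →
          ∀ Gε : Set (ℝ × ℝ),
            Gε = ⋃ j ∈ Finset.range N,
              {x : ℝ × ℝ | |x.1 / ε - ((j : ℝ) + 1 / 2)| < h / 2 ∧ x.2 ∈ Set.Ioo (-l) 0} →
            ∀ u : ℝ × ℝ → ℝ, ContDiff ℝ 1 u →
              (∀ x₁ : ℝ, (∃ j ∈ Finset.range N,
                  |x₁ / ε - ((j : ℝ) + 1 / 2)| < h / 2) → u (x₁, -l) = 0) →
              Real.sqrt (∫ x in Ω₀ ∪ Gε, ‖fderiv ℝ u x‖ ^ 2) ≤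
                  Real.sqrt (∫ x in Ω₀ ∪ Gε, (‖fderiv ℝ u x‖ ^ 2 + (u x) ^ 2)) ∧
                Real.sqrt (∫ x in Ω₀ ∪ Gε, (‖fderiv ℝ u x‖ ^ 2 + (u x) ^ 2)) ≤
                  C₁ * Real.sqrt (∫ x in Ω₀ ∪ Gε, ‖fderiv ℝ u x‖ ^ 2) := by
  have hγc : ContinuousOn γ (Set.Icc 0 a) := hγ.continuousOn
  have hne : (Set.Icc 0 a).Nonempty := Set.nonempty_Icc.2 ha.le
  obtain ⟨xm, hxm, hmin⟩ := isCompact_Icc.exists_isMinOn hne hγc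
  obtain ⟨xM, hxM, hmax⟩ := isCompact_Icc.exists_isMaxOn hne hγc
  set m := γ xm with hm_def
  set M := γ xM with hM_def
  have hm : 0 < m := hγpos xm hxm
  have hM : 0 < M := hγpos xM hxM
  have hγm : ∀ x ∈ Set.Ioo 0 a, m ≤ γ x := fun x hx => hmin (Set.Ioo_subset_Icc_self hx)
  have hγM : ∀ x ∈ Set.Ioo 0 a, γ x ≤ M := fun x hx => hmax (Set.Ioo_subset_Icc_self hx)
  have hΩm : MeasurableSet Ω₀ := hΩ₀ ▸ measurableSet_subgraph_Ioo hγc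
  have hh0 : 0 < h := hh.1
  have hh1 : h < 1 := hh.2
  set K : ℝ := 2 * M / m * (2 / h * (m + l) ^ 2 + 2 * a ^ 2) + 2 * M ^ 2 + (m + l) ^ 2 with hK
  have hK0 : 0 < K := by positivity
  refine ⟨Real.sqrt (1 + K), by positivity, 1, one_pos, ?_⟩
  intro N hN ε hε _ Gε hGε u hu hu0
  have hN' : (1 : ℝ) ≤ N := by exact_mod_cast hN
  have hN0 : (0 : ℝ) < N := by linarith
  have hε0 : 0 < ε := hε ▸ div_pos ha hN0
  have hεN : ε * N = a := by rw [hε]; field_simp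
  have hεa : ε ≤ a := by nlinarith
  set T : Set ℝ := {x | ∃ j ∈ Finset.range N, |x / ε - ((j : ℝ) + 1 / 2)| < h / 2} with hTdef
  have hcell : ∀ (x : ℝ) (j : ℕ), |x / ε - ((j : ℝ) + 1 / 2)| < h / 2 ↔
      x ∈ Set.Ioo (ε * (j + (1 - h) / 2)) (ε * (j + (1 + h) / 2)) := by
    intro x j
    rw [abs_lt, Set.mem_Ioo, ← lt_div_iff₀' hε0, ← div_lt_iff₀' hε0]
    constructor <;> rintro ⟨h1, h2⟩ <;> constructor <;> linarith
  have hTeq : T = ⋃ j ∈ Finset.range N,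
      Set.Ioo (ε * ((j : ℝ) + (1 - h) / 2)) (ε * (j + (1 + h) / 2)) := by
    ext x
    simp only [hTdef, hcell, Set.mem_ofPred_eq, Set.mem_iUnion, exists_prop]
  have hT : MeasurableSet T := by
    rw [hTeq]
    exact Finset.measurableSet_biUnion _ fun j _ => measurableSet_Ioo
  have hTsub : ∀ j < N, Set.Ioo (ε * ((j : ℝ) + (1 - h) / 2)) (ε * (j + (1 + h) / 2)) ⊆ T :=
    fun j hj x hx => ⟨j, Finset.mem_range.2 hj, (hcell x j).2 hx⟩
  have hTa : T ⊆ Set.Ioo 0 a := by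
    rintro x ⟨j, hj, hx⟩
    rw [hcell] at hx
    have hj' : (j : ℝ) + 1 ≤ N := by exact_mod_cast Finset.mem_range.1 hj
    have hj0 : (0 : ℝ) ≤ j := Nat.cast_nonneg j
    refine ⟨lt_trans (mul_pos hε0 (by linarith)) hx.1, hx.2.trans_le ?_⟩
    rw [← hεN]
    exact mul_le_mul_of_nonneg_left (by linarith) hε0.le
  have hG : Gε = T ×ˢ Set.Ioo (-l) 0 := by
    rw [hGε]
    ext x
    simp only [hTdef, Set.mem_iUnion, Set.mem_ofPred_eq, Set.mem_prod, exists_prop]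
    constructor
    · rintro ⟨j, hj, h1, h2⟩
      exact ⟨⟨j, hj, h1⟩, h2⟩
    · rintro ⟨⟨j, hj, h1⟩, h2⟩
      exact ⟨j, hj, h1, h2⟩
  have key := lintegral_sq_le_thick_junction hu hl hh hm hε0 hεa hεN hγm hγM hΩ₀ hΩm hT hTa
    hTsub hu0
  rw [← hG] at key
  have hsub : Ω₀ ∪ Gε ⊆ Set.Icc 0 a ×ˢ Set.Icc (-l) M := by
    rw [hG, hΩ₀]
    rintro ⟨x, y⟩ (⟨h1, h2, h3, h4⟩ | ⟨hx, hy⟩)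
    · exact ⟨⟨h1.le, h2.le⟩, by dsimp at *; linarith, (h4.trans_le (hγM x ⟨h1, h2⟩)).le⟩
    · exact ⟨Set.Ioo_subset_Icc_self (hTa hx), hy.1.le, hy.2.le.trans hM.le⟩
  have hint : ∀ f : ℝ × ℝ → ℝ, Continuous f → IntegrableOn f (Ω₀ ∪ Gε) := fun f hf =>
    (hf.continuousOn.integrableOn_compact (isCompact_Icc.prod isCompact_Icc)).mono_set hsub
  have hu' : Continuous (fderiv ℝ u) := hu.continuous_fderiv one_ne_zero
  have hiD := hint (fun z => ‖fderiv ℝ u z‖ ^ 2) (by fun_prop)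
  have hiU := hint (fun z => u z ^ 2) (hu.continuous.pow 2)
  set D := ∫ x in Ω₀ ∪ Gε, ‖fderiv ℝ u x‖ ^ 2 with hD
  set U := ∫ x in Ω₀ ∪ Gε, u x ^ 2 with hU
  have hD0 : 0 ≤ D := integral_nonneg fun _ => sq_nonneg _
  have hU0 : 0 ≤ U := integral_nonneg fun _ => sq_nonneg _
  have hsum : ∫ x in Ω₀ ∪ Gε, (‖fderiv ℝ u x‖ ^ 2 + u x ^ 2) = D + U := integral_add hiD hiU
  have hUD : U ≤ K * D := by
    rw [← ofReal_integral_eq_lintegral_ofReal hiU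
        (Filter.Eventually.of_forall fun _ => sq_nonneg _),
      ← ofReal_integral_eq_lintegral_ofReal hiD
        (Filter.Eventually.of_forall fun _ => sq_nonneg _),
      ← ENNReal.ofReal_mul (by positivity), ← ENNReal.ofReal_add (by positivity) (by positivity),
      ← ENNReal.ofReal_mul (by positivity), ← ENNReal.ofReal_add (by positivity) (by positivity),
      ← ENNReal.ofReal_add (by positivity) (by positivity),
      ← ENNReal.ofReal_mul (by positivity)] at key
    exact (ENNReal.ofReal_le_ofReal_iff (by positivity)).1 key
  rw [hsum]
  refine ⟨Real.sqrt_le_sqrt (by linarith), ?_⟩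
  rw [← Real.sqrt_mul (by positivity)]
  exact Real.sqrt_le_sqrt (by linarith)
end

section
/- There exist constants C₂ > 0 and ε₀ > 0 such that for every positive integer N with ε = a/N ∈ (0, ε₀) and every continuously differentiable function u : ℝ² → ℝ vanishing on Γ_ε (i.e. u(x₁, −l) = 0 whenever (x₁,−l) lies on the base of one of the rods), the uniform Friedrich inequality ∫_{Ω_ε} u(x)² dx ≤ C₂² ∫_{Ω_ε} ‖∇u(x)‖² dx holds, with C₂ and ε₀ independent of N. -/
open MeasureTheory

theorem enorm_sub_sq_le_mul_lintegral {f f' : ℝ → ℝ} (hf : ∀ t, HasDerivAt f (f' t) t)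
    (hf' : Continuous f') {a b L : ℝ} {S : Set ℝ} (hS : Set.uIoc a b ≤ᵐ[volume] S)
    (hL : |b - a| ≤ L) :
    ‖f b - f a‖ₑ ^ 2 ≤ ENNReal.ofReal L * ∫⁻ t in S, ‖f' t‖ₑ ^ 2 := by
  have h1 : ‖f b - f a‖ₑ ≤ ∫⁻ t in Set.uIoc a b, ‖f' t‖ₑ := by
    rw [← intervalIntegral.integral_eq_sub_of_hasDerivAt (fun t _ => hf t)
      (hf'.intervalIntegrable a b)]
    have h2 : ‖∫ t in a..b, f' t‖ₑ = ‖∫ t in Set.uIoc a b, f' t‖ₑ := by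
      rw [← ofReal_norm, ← ofReal_norm, intervalIntegral.norm_intervalIntegral_eq]
    rw [h2]
    exact enorm_integral_le_lintegral_enorm _
  have h3 := ENNReal.lintegral_mul_le_Lp_mul_Lq (volume.restrict (Set.uIoc a b))
    Real.HolderConjugate.two_two (f := fun _ => 1) (g := fun t => ‖f' t‖ₑ)
    aemeasurable_const hf'.measurable.enorm.aemeasurable
  have h4 : (∫⁻ t in Set.uIoc a b, ‖f' t‖ₑ) ^ 2
      ≤ volume (Set.uIoc a b) * ∫⁻ t in Set.uIoc a b, ‖f' t‖ₑ ^ 2 := by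
    have hp : ∀ x : ENNReal, (x ^ (1 / 2 : ℝ)) ^ 2 = x := fun x => by
      rw [← ENNReal.rpow_natCast, ← ENNReal.rpow_mul]; norm_num
    have h5 := pow_le_pow_left' h3 2
    rw [mul_pow, hp, hp] at h5
    simpa using h5
  have hvol : volume (Set.uIoc a b) ≤ ENNReal.ofReal L := by
    rw [Set.uIoc, Real.volume_Ioc, max_sub_min_eq_abs]
    exact ENNReal.ofReal_le_ofReal hL
  calc ‖f b - f a‖ₑ ^ 2 ≤ _ := pow_le_pow_left' h1 2
    _ ≤ _ := h4
    _ ≤ _ := mul_le_mul' hvol (lintegral_mono_set' hS)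

theorem enorm_sub_sq_le_mul_lintegral_fderiv {u : ℝ × ℝ → ℝ} (hu : ContDiff ℝ 1 u)
    {g : ℝ → ℝ × ℝ} {v : ℝ × ℝ} (hg : ∀ t, HasDerivAt g v t) (hv : ‖v‖ ≤ 1)
    {a b L : ℝ} {S : Set ℝ} (hS : Set.uIoc a b ≤ᵐ[volume] S) (hL : |b - a| ≤ L) :
    ‖u (g b) - u (g a)‖ₑ ^ 2 ≤ ENNReal.ofReal L * ∫⁻ t in S, ‖fderiv ℝ u (g t)‖ₑ ^ 2 := by
  have hgc : Continuous g := continuous_iff_continuousAt.2 fun t => (hg t).continuousAt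
  have hc : Continuous fun t => fderiv ℝ u (g t) v :=
    ((hu.continuous_fderiv one_ne_zero).comp hgc).clm_apply continuous_const
  refine (enorm_sub_sq_le_mul_lintegral (f := fun t => u (g t)) (fun t =>
    ((hu.differentiable one_ne_zero (g t)).hasFDerivAt.comp_hasDerivAt t (hg t))) hc hS hL).trans ?_
  gcongr with t
  rw [← ofReal_norm, ← ofReal_norm]
  exact ENNReal.ofReal_le_ofReal
    ((ContinuousLinearMap.le_opNorm _ _).trans (mul_le_of_le_one_right (norm_nonneg _) hv))

theorem enorm_sub_sq_le_vertical {u : ℝ × ℝ → ℝ} (hu : ContDiff ℝ 1 u) (x : ℝ)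
    {a b L : ℝ} {S : Set ℝ} (hS : Set.uIoc a b ≤ᵐ[volume] S) (hL : |b - a| ≤ L) :
    ‖u (x, b) - u (x, a)‖ₑ ^ 2 ≤ ENNReal.ofReal L * ∫⁻ t in S, ‖fderiv ℝ u (x, t)‖ₑ ^ 2 :=
  enorm_sub_sq_le_mul_lintegral_fderiv hu (v := (0, 1))
    (fun t => (hasDerivAt_const t x).prodMk (hasDerivAt_id t)) (by simp [Prod.norm_def]) hS hL

theorem enorm_sub_sq_le_horizontal {u : ℝ × ℝ → ℝ} (hu : ContDiff ℝ 1 u) (y : ℝ)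
    {a b L : ℝ} {S : Set ℝ} (hS : Set.uIoc a b ≤ᵐ[volume] S) (hL : |b - a| ≤ L) :
    ‖u (b, y) - u (a, y)‖ₑ ^ 2 ≤ ENNReal.ofReal L * ∫⁻ t in S, ‖fderiv ℝ u (t, y)‖ₑ ^ 2 :=
  enorm_sub_sq_le_mul_lintegral_fderiv hu (v := (1, 0))
    (fun t => (hasDerivAt_id t).prodMk (hasDerivAt_const t y)) (by simp [Prod.norm_def]) hS hL

theorem setLIntegral_eq_lintegral_section {S : Set (ℝ × ℝ)} (hS : MeasurableSet S)
    {F : ℝ × ℝ → ENNReal} (hF : Measurable F) :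
    ∫⁻ z in S, F z = ∫⁻ x, ∫⁻ y in Prod.mk x ⁻¹' S, F (x, y) := by
  rw [← lintegral_indicator hS, Measure.volume_eq_prod,
    lintegral_prod _ (hF.indicator hS).aemeasurable]
  refine lintegral_congr fun x => ?_
  rw [← lintegral_indicator (measurable_prodMk_left hS)]
  rfl

theorem setLIntegral_eq_lintegral_section_symm {S : Set (ℝ × ℝ)} (hS : MeasurableSet S)
    {F : ℝ × ℝ → ENNReal} (hF : Measurable F) :
    ∫⁻ z in S, F z = ∫⁻ y, ∫⁻ x in (fun x => (x, y)) ⁻¹' S, F (x, y) := by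
  rw [← lintegral_indicator hS, Measure.volume_eq_prod,
    lintegral_prod_symm _ (hF.indicator hS).aemeasurable]
  refine lintegral_congr fun y => ?_
  rw [← lintegral_indicator (measurable_prodMk_right hS)]
  rfl

theorem measurable_lintegral_section {S : Set (ℝ × ℝ)} (hS : MeasurableSet S)
    {F : ℝ × ℝ → ENNReal} (hF : Measurable F) :
    Measurable fun x => ∫⁻ y in Prod.mk x ⁻¹' S, F (x, y) := by
  have : (fun x => ∫⁻ y in Prod.mk x ⁻¹' S, F (x, y)) = fun x => ∫⁻ y, S.indicator F (x, y) := by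
    funext x
    rw [← lintegral_indicator (measurable_prodMk_left hS)]
    rfl
  rw [this]
  exact (hF.indicator hS).lintegral_prod_right'

theorem measurable_lintegral_section_symm {S : Set (ℝ × ℝ)} (hS : MeasurableSet S)
    {F : ℝ × ℝ → ENNReal} (hF : Measurable F) :
    Measurable fun y => ∫⁻ x in (fun x => (x, y)) ⁻¹' S, F (x, y) := by
  have : (fun y => ∫⁻ x in (fun x => (x, y)) ⁻¹' S, F (x, y))
      = fun y => ∫⁻ x, S.indicator F (x, y) := by
    funext y
    rw [← lintegral_indicator (measurable_prodMk_right hS)]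
    rfl
  rw [this]
  exact (hF.indicator hS).lintegral_prod_left'

theorem exists_mem_Ioo_le_lintegral_div {f : ℝ → ENNReal} (hf : Measurable f) {p q : ℝ}
    (hpq : p < q) : ∃ x ∈ Set.Ioo p q, f x ≤ ENNReal.ofReal (1 / (q - p)) * ∫⁻ t, f t := by
  have hv : volume (Set.Ioo p q) = ENNReal.ofReal (q - p) := Real.volume_Ioo
  have hpos : 0 < q - p := sub_pos.2 hpq
  obtain ⟨x, hx, h⟩ := exists_le_setLAverage (μ := volume) (s := Set.Ioo p q) (f := f)
    (by simpa [hv] using hpq) (by simp [hv]) hf.aemeasurable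
  refine ⟨x, hx, h.trans ?_⟩
  rw [setLAverage_eq, hv, ENNReal.div_eq_inv_mul, one_div, ENNReal.ofReal_inv_of_pos hpos]
  exact mul_le_mul_right (setLIntegral_le_lintegral _ _) _

theorem enorm_add_three_sq_le (x y z : ℝ) :
    ‖x + y + z‖ₑ ^ 2 ≤ 3 * (‖x‖ₑ ^ 2 + ‖y‖ₑ ^ 2 + ‖z‖ₑ ^ 2) := by
  have he : ∀ r : ℝ, ‖r‖ₑ ^ 2 = ENNReal.ofReal (r ^ 2) := fun r => by
    rw [← ofReal_norm, ← ENNReal.ofReal_pow (norm_nonneg _), Real.norm_eq_abs, sq_abs]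
  have h3 : (3 : ENNReal) = ENNReal.ofReal 3 := by simp
  rw [he, he, he, he, ← ENNReal.ofReal_add (by positivity) (by positivity),
    ← ENNReal.ofReal_add (by positivity) (by positivity), h3, ← ENNReal.ofReal_mul (by norm_num)]
  exact ENNReal.ofReal_le_ofReal
    (by nlinarith [sq_nonneg (x - y), sq_nonneg (y - z), sq_nonneg (x - z)])

/-- Friedrichs inequality on a single rod. -/
theorem lintegral_rod_le {u : ℝ × ℝ → ℝ} (hu : ContDiff ℝ 1 u) {p q l : ℝ} (hl : 0 < l)
    (h0 : ∀ y ∈ Set.Ioo p q, u (y, -l) = 0) :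
    ∫⁻ z in Set.Ioo p q ×ˢ Set.Ioo (-l) 0, ‖u z‖ₑ ^ 2
      ≤ ENNReal.ofReal (l ^ 2) * ∫⁻ z in Set.Ioo p q ×ˢ Set.Ioo (-l) 0, ‖fderiv ℝ u z‖ₑ ^ 2 := by
  have hS : MeasurableSet (Set.Ioo p q ×ˢ Set.Ioo (-l) 0) := measurableSet_Ioo.prod measurableSet_Ioo
  rw [setLIntegral_eq_lintegral_section hS (hu.continuous.measurable.enorm.pow_const 2),
    setLIntegral_eq_lintegral_section hS
      ((hu.continuous_fderiv one_ne_zero).measurable.enorm.pow_const 2),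
    ← lintegral_const_mul' _ _ ENNReal.ofReal_ne_top]
  refine lintegral_mono fun x => ?_
  by_cases hx : x ∈ Set.Ioo p q
  · simp only [Set.mk_preimage_prod_right hx]
    refine (setLIntegral_mono' (g := fun _ => ENNReal.ofReal l *
      ∫⁻ t in Set.Ioo (-l) 0, ‖fderiv ℝ u (x, t)‖ₑ ^ 2) measurableSet_Ioo fun y hy => ?_).trans ?_
    · have := enorm_sub_sq_le_vertical hu x (a := -l) (b := y) (L := l) (S := Set.Ioo (-l) 0)
        (Filter.Eventually.of_forall fun t ht => by
          rw [Set.uIoc_of_le hy.1.le] at ht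
          exact ⟨ht.1, ht.2.trans_lt hy.2⟩)
        (by rw [abs_of_pos] <;> linarith [hy.1, hy.2])
      simpa [h0 x hx] using this
    · rw [setLIntegral_const, Real.volume_Ioo, sq, ENNReal.ofReal_mul hl.le]
      simp only [sub_neg_eq_add, zero_add]
      exact le_of_eq (by ring)
  · simp [Set.mk_preimage_prod_right_eq_empty hx]

theorem lintegral_section_comp_fst_le {Ω H : Set (ℝ × ℝ)} (hΩ : MeasurableSet Ω)
    (hH : MeasurableSet H) {M : ℝ} (hM : ∀ z ∈ Ω, z.2 ∈ Set.Ioo 0 M)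
    {F : ℝ × ℝ → ENNReal} (hF : Measurable F) :
    ∫⁻ z in Ω, ∫⁻ t in Prod.mk z.1 ⁻¹' H, F (z.1, t) ≤ ENNReal.ofReal M * ∫⁻ z in H, F z := by
  have hmeas := (measurable_lintegral_section hH hF)
  rw [setLIntegral_eq_lintegral_section (F := fun z => ∫⁻ t in Prod.mk z.1 ⁻¹' H, F (z.1, t)) hΩ
    (hmeas.comp measurable_fst), setLIntegral_eq_lintegral_section hH hF, ← lintegral_const_mul' _ _ ENNReal.ofReal_ne_top]
  refine lintegral_mono fun x => ?_
  simp only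
  rw [setLIntegral_const, mul_comm]
  gcongr
  calc volume (Prod.mk x ⁻¹' Ω) ≤ volume (Set.Ioo 0 M) := measure_mono fun y hy => hM _ hy
    _ = _ := by rw [Real.volume_Ioo, sub_zero]

/-- The part of the junction body above one cell is controlled by the cell and its rod. -/
theorem lintegral_body_cell_le {u : ℝ × ℝ → ℝ} (hu : ContDiff ℝ 1 u) {γ : ℝ → ℝ}
    (hγ : Continuous γ) {m M : ℝ} (hm : 0 < m) (hmγ : ∀ x, m ≤ γ x) (hγM : ∀ x, γ x ≤ M)
    {J : Set ℝ} (hJm : MeasurableSet J) {c e p q l : ℝ} (he : 0 < e) (hl : 0 < l)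
    (hJ : Set.Ioo c (c + e) ⊆ J) (hJ' : J ⊆ Set.Icc c (c + e)) (hpq : p < q)
    (hR : Set.Ioo p q ⊆ J) (h0 : ∀ y ∈ Set.Ioo p q, u (y, -l) = 0)
    {Ω H : Set (ℝ × ℝ)} (hΩ : Ω = {z | z.1 ∈ J ∧ 0 < z.2 ∧ z.2 < γ z.1})
    (hH : H = Ω ∪ Set.Ioo p q ×ˢ Set.Ioo (-l) 0) :
    ∫⁻ z in Ω, ‖u z‖ₑ ^ 2
      ≤ ENNReal.ofReal (3 * (M * M + (e * (1 / m) + (l + m) * (1 / (q - p))) * (e * M)))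
        * ∫⁻ z in H, ‖fderiv ℝ u z‖ₑ ^ 2 := by
  have hM : 0 < M := hm.trans_le ((hmγ 0).trans (hγM 0))
  have hpq' : 0 < q - p := sub_pos.2 hpq
  have hΩm : MeasurableSet Ω := by
    rw [hΩ]
    exact (measurable_fst hJm).inter ((measurableSet_lt measurable_const measurable_snd).inter
      (measurableSet_lt measurable_snd (hγ.measurable.comp measurable_fst)))
  have hHm : MeasurableSet H := by
    rw [hH]; exact hΩm.union (measurableSet_Ioo.prod measurableSet_Ioo)
  have hΩmem : ∀ x y, (x, y) ∈ Ω ↔ x ∈ J ∧ 0 < y ∧ y < γ x := fun x y => by rw [hΩ]; rfl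
  have hΩH : Ω ⊆ H := by rw [hH]; exact Set.subset_union_left
  have hGH : ∀ x y, x ∈ Set.Ioo p q → y ∈ Set.Ioo (-l) 0 → (x, y) ∈ H := fun x y hx hy => by
    rw [hH]; exact Or.inr ⟨hx, hy⟩
  have hF : Measurable fun z => ‖fderiv ℝ u z‖ₑ ^ 2 :=
    (hu.continuous_fderiv one_ne_zero).measurable.enorm.pow_const 2
  obtain ⟨y, hy, hyle⟩ :=
    exists_mem_Ioo_le_lintegral_div (measurable_lintegral_section hHm hF) hpq
  obtain ⟨s, hs, hsle⟩ :=
    exists_mem_Ioo_le_lintegral_div (measurable_lintegral_section_symm hHm hF) hm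
  rw [← setLIntegral_eq_lintegral_section hHm hF] at hyle
  rw [← setLIntegral_eq_lintegral_section_symm hHm hF, sub_zero] at hsle
  set I := ∫⁻ z in H, ‖fderiv ℝ u z‖ₑ ^ 2 with hI
  have hyJ := hR hy
  have key : ∀ z ∈ Ω, ‖u z‖ₑ ^ 2 ≤
      ENNReal.ofReal (3 * M) * (∫⁻ t in Prod.mk z.1 ⁻¹' H, ‖fderiv ℝ u (z.1, t)‖ₑ ^ 2)
        + ENNReal.ofReal (3 * (e * (1 / m) + (l + m) * (1 / (q - p)))) * I := by
    rintro ⟨x₁, x₂⟩ hz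
    obtain ⟨hx₁, hx₂, hx₂'⟩ := (hΩmem _ _).1 hz
    have hxM := hx₂'.trans_le (hγM x₁)
    have hsM := hs.2.trans_le ((hmγ x₁).trans (hγM x₁))
    have hsγ := fun x => hs.2.trans_le (hmγ x)
    have t1 := enorm_sub_sq_le_vertical hu x₁ (a := s) (b := x₂) (L := M) (S := Prod.mk x₁ ⁻¹' H)
      (Filter.Eventually.of_forall fun t ht => by
        obtain ⟨h1, h2⟩ := ht
        exact hΩH ((hΩmem _ _).2 ⟨hx₁, (lt_min hs.1 hx₂).trans h1, h2.trans_lt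
          (max_lt (hsγ x₁) hx₂')⟩))
      (by rw [abs_le]; constructor <;> linarith [hs.1])
    have t2 := enorm_sub_sq_le_horizontal hu s (a := y) (b := x₁) (L := e)
      (S := (fun x => (x, s)) ⁻¹' H)
      (by
        filter_upwards [compl_mem_ae_iff.2 (measure_singleton (μ := volume) (c + e))] with t htne ht
        obtain ⟨h1, h2⟩ := ht
        have hlow : c < t := (le_min (hJ' hyJ).1 (hJ' hx₁).1).trans_lt h1
        have hup : t ≤ c + e := h2.trans (max_le (hJ' hyJ).2 (hJ' hx₁).2)
        exact hΩH ((hΩmem _ _).2 ⟨hJ ⟨hlow, lt_of_le_of_ne hup htne⟩, hs.1, hsγ t⟩))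
      (by
        have h1 := hJ' hyJ
        have h2 := hJ' hx₁
        rw [abs_le]; constructor <;> linarith [h1.1, h1.2, h2.1, h2.2])
    have t3 := enorm_sub_sq_le_vertical hu y (a := -l) (b := s) (L := l + m)
      (S := Prod.mk y ⁻¹' H)
      (by
        filter_upwards [compl_mem_ae_iff.2 (measure_singleton (μ := volume) (0 : ℝ))] with t htne ht
        rw [Set.uIoc_of_le (by linarith [hs.1])] at ht
        rcases lt_or_gt_of_ne htne with h | h
        · exact hGH _ _ hy ⟨ht.1, h⟩
        · exact hΩH ((hΩmem _ _).2 ⟨hyJ, h, ht.2.trans_lt (hsγ y)⟩))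
      (by rw [abs_of_pos] <;> linarith [hs.1, hs.2])
    rw [h0 y hy, sub_zero] at t3
    have hsum := enorm_add_three_sq_le (u (x₁, x₂) - u (x₁, s)) (u (x₁, s) - u (y, s)) (u (y, s))
    rw [show u (x₁, x₂) - u (x₁, s) + (u (x₁, s) - u (y, s)) + u (y, s) = u (x₁, x₂) by ring]
      at hsum
    have h3 : (3 : ENNReal) = ENNReal.ofReal 3 := by simp
    refine hsum.trans ?_
    calc _ ≤ 3 * (ENNReal.ofReal M * (∫⁻ t in Prod.mk x₁ ⁻¹' H, ‖fderiv ℝ u (x₁, t)‖ₑ ^ 2)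
          + ENNReal.ofReal e * (ENNReal.ofReal (1 / m) * I)
          + ENNReal.ofReal (l + m) * (ENNReal.ofReal (1 / (q - p)) * I)) := by
          gcongr
          · exact t2.trans (by gcongr)
          · exact t3.trans (by gcongr)
      _ = _ := by
          rw [ENNReal.ofReal_mul (by norm_num), ENNReal.ofReal_mul (by norm_num),
            ENNReal.ofReal_add (p := e * (1 / m)) (by positivity) (by positivity),
            ENNReal.ofReal_mul (by positivity), ENNReal.ofReal_mul (by positivity), ← h3]
          ring
  have hΩM : ∀ z ∈ Ω, z.2 ∈ Set.Ioo 0 M := fun z hz => by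
    have := (hΩmem z.1 z.2).1 hz
    exact ⟨this.2.1, this.2.2.trans_le (hγM _)⟩
  have hvol : volume Ω ≤ ENNReal.ofReal (e * M) := by
    calc volume Ω ≤ volume (Set.Icc c (c + e) ×ˢ Set.Ioo 0 M) :=
          measure_mono fun z hz => ⟨hJ' ((hΩmem z.1 z.2).1 hz).1, hΩM z hz⟩
      _ = _ := by
          rw [Measure.volume_eq_prod, Measure.prod_prod, Real.volume_Icc, Real.volume_Ioo,
            add_sub_cancel_left, sub_zero, ENNReal.ofReal_mul he.le]
  refine (setLIntegral_mono' hΩm key).trans ?_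
  rw [lintegral_add_right _ measurable_const, setLIntegral_const,
    lintegral_const_mul' _ _ ENNReal.ofReal_ne_top]
  calc _ ≤ ENNReal.ofReal (3 * M) * (ENNReal.ofReal M * I)
        + ENNReal.ofReal (3 * (e * (1 / m) + (l + m) * (1 / (q - p)))) * I
          * ENNReal.ofReal (e * M) := by
        gcongr
        exact lintegral_section_comp_fst_le hΩm hHm hΩM hF
    _ = _ := by
        rw [mul_right_comm, ← mul_assoc, ← ENNReal.ofReal_mul (by positivity),
          ← ENNReal.ofReal_mul (by positivity), ← add_mul,
          ← ENNReal.ofReal_add (by positivity) (by positivity)]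
        congr 2
        ring

theorem setIntegral_sq_le_of_lintegral_le {u : ℝ × ℝ → ℝ} (hu : ContDiff ℝ 1 u) {S T : Set (ℝ × ℝ)}
    (hT : IsCompact T) (hST : S ⊆ T) {K : ℝ} (hK : 0 ≤ K)
    (h : ∫⁻ z in S, ‖u z‖ₑ ^ 2 ≤ ENNReal.ofReal K * ∫⁻ z in S, ‖fderiv ℝ u z‖ₑ ^ 2) :
    ∫ z in S, u z ^ 2 ≤ K * ∫ z in S, ‖fderiv ℝ u z‖ ^ 2 := by
  have hU : IntegrableOn (fun z => u z ^ 2) S :=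
    ((hu.continuous.pow 2).continuousOn.integrableOn_compact hT).mono_set hST
  have hW : IntegrableOn (fun z => ‖fderiv ℝ u z‖ ^ 2) S :=
    (((hu.continuous_fderiv one_ne_zero).norm.pow 2).continuousOn.integrableOn_compact hT).mono_set
      hST
  have hnonneg : 0 ≤ ∫ z in S, ‖fderiv ℝ u z‖ ^ 2 := integral_nonneg fun z => by positivity
  rw [← ENNReal.ofReal_le_ofReal_iff (mul_nonneg hK hnonneg), ENNReal.ofReal_mul hK,
    ofReal_integral_eq_lintegral_ofReal hU (Filter.Eventually.of_forall fun z => sq_nonneg _),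
    ofReal_integral_eq_lintegral_ofReal hW (Filter.Eventually.of_forall fun z => sq_nonneg _)]
  convert h using 4 with z z
  · rw [← ofReal_norm, ← ENNReal.ofReal_pow (norm_nonneg _), Real.norm_eq_abs, sq_abs]
  · rw [← ofReal_norm, ← ENNReal.ofReal_pow (norm_nonneg _)]

/-- Uniform Friedrich inequality on the thick junction `Ω_ε = Ω₀ ∪ G_ε`, for functions
vanishing on the bases `Γ_ε` of the thin rods, with constants independent of `ε = a/N`. -/
theorem signorini_uniform_friedrich_inequality
    (a l h : ℝ) (ha : 0 < a) (hl : 0 < l) (hh : h ∈ Set.Ioo (0 : ℝ) 1)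
    (γ : ℝ → ℝ) (hγ : ContDiffOn ℝ 1 γ (Set.Icc 0 a))
    (hγpos : ∀ x₁ ∈ Set.Icc (0 : ℝ) a, 0 < γ x₁)
    (Ω₀ : Set (ℝ × ℝ))
    (hΩ₀ : Ω₀ = {x : ℝ × ℝ | 0 < x.1 ∧ x.1 < a ∧ 0 < x.2 ∧ x.2 < γ x.1}) :
    ∃ C₂ : ℝ, 0 < C₂ ∧ ∃ ε₀ : ℝ, 0 < ε₀ ∧
      ∀ (N : ℕ), 0 < N →
        ∀ ε : ℝ, ε = a / N → ε < ε₀ →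
          ∀ Gε : Set (ℝ × ℝ),
            Gε = ⋃ j ∈ Finset.range N,
              {x : ℝ × ℝ | |x.1 / ε - ((j : ℝ) + 1 / 2)| < h / 2 ∧ x.2 ∈ Set.Ioo (-l) 0} →
            ∀ u : ℝ × ℝ → ℝ, ContDiff ℝ 1 u →
              (∀ x₁ : ℝ, (∃ j ∈ Finset.range N,
                  |x₁ / ε - ((j : ℝ) + 1 / 2)| < h / 2) → u (x₁, -l) = 0) →
              (∫ x in Ω₀ ∪ Gε, (u x) ^ 2) ≤ C₂ ^ 2 * ∫ x in Ω₀ ∪ Gε, ‖fderiv ℝ u x‖ ^ 2 := by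
  obtain ⟨hh0, hh1⟩ := hh
  have hne : (Set.Icc 0 a).Nonempty := ⟨0, le_rfl, ha.le⟩
  obtain ⟨xm, hxm, hmin⟩ := isCompact_Icc.exists_isMinOn hne hγ.continuousOn
  obtain ⟨xM, hxM, hmax⟩ := isCompact_Icc.exists_isMaxOn hne hγ.continuousOn
  set m := γ xm
  set M := γ xM
  have hm : 0 < m := hγpos _ hxm
  have hM : 0 < M := hγpos _ hxM
  obtain ⟨g, hgc, hgγ, hmg, hgM⟩ : ∃ g : ℝ → ℝ, Continuous g ∧ (∀ x ∈ Set.Icc 0 a, g x = γ x) ∧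
      (∀ x, m ≤ g x) ∧ ∀ x, g x ≤ M :=
    ⟨Set.IccExtend ha.le ((Set.Icc 0 a).domRestrict γ),
      (continuousOn_iff_continuous_domRestrict.1 hγ.continuousOn).Icc_extend',
      fun x hx => Set.IccExtend_of_mem _ _ hx,
      fun x => hmin (Set.projIcc 0 a ha.le x).2, fun x => hmax (Set.projIcc 0 a ha.le x).2⟩
  set K := 3 * (M * M + (a * (1 / m) * (a * M) + (l + m) * M / h)) + l ^ 2 with hKdef
  have hK : 0 < K := by positivity
  refine ⟨√K, Real.sqrt_pos.2 hK, 1, one_pos, ?_⟩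
  intro N hN ε hε _ Gε hG u hu hu0
  rw [Real.sq_sqrt hK.le]
  have hN' : (1 : ℝ) ≤ N := by exact_mod_cast hN
  have hε0 : 0 < ε := by rw [hε]; positivity
  have hεa : ε ≤ a := by rw [hε]; exact div_le_self ha.le hN'
  have hNε : (N : ℝ) * ε = a := by rw [hε]; field_simp
  have habs : ∀ (j : ℕ) (x : ℝ), |x / ε - ((j : ℝ) + 1 / 2)| < h / 2 ↔
      x ∈ Set.Ioo (ε * (j + (1 - h) / 2)) (ε * (j + (1 + h) / 2)) := fun j x => by
    rw [abs_lt, Set.mem_Ioo, neg_lt_sub_iff_lt_add, sub_lt_iff_lt_add, ← lt_div_iff₀' hε0,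
      ← div_lt_iff₀' hε0]
    constructor <;> rintro ⟨h1, h2⟩ <;> constructor <;> linarith
  let J : ℕ → Set ℝ := fun j => Set.Ico (ε * j) (ε * j + ε) ∩ Set.Ioo 0 a
  let R : ℕ → Set ℝ := fun j => Set.Ioo (ε * (j + (1 - h) / 2)) (ε * (j + (1 + h) / 2))
  let Ω : ℕ → Set (ℝ × ℝ) := fun j => {z | z.1 ∈ J j ∧ 0 < z.2 ∧ z.2 < g z.1}
  let H : ℕ → Set (ℝ × ℝ) := fun j => Ω j ∪ R j ×ˢ Set.Ioo (-l) 0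
  have hJIoo : ∀ j < N, Set.Ioo (ε * j) (ε * j + ε) ⊆ J j := fun j hj x hx => by
    have hj' : (j : ℝ) + 1 ≤ N := by exact_mod_cast hj
    have : 0 ≤ ε * j := by positivity
    exact ⟨⟨hx.1.le, hx.2⟩, this.trans_lt hx.1, by nlinarith [hx.2]⟩
  have hRIoo : ∀ j, R j ⊆ Set.Ioo (ε * j) (ε * j + ε) := fun j x hx => by
    constructor <;> nlinarith [hx.1, hx.2]
  have hHfst : ∀ j, ∀ z ∈ H j, z.1 ∈ Set.Ico (ε * j) (ε * j + ε) := by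
    rintro j z (hz | hz)
    · exact hz.1.1
    · exact Set.Ioo_subset_Ico_self (hRIoo j hz.1)
  have hset : Ω₀ ∪ Gε = ⋃ j ∈ Finset.range N, H j := by
    ext ⟨x, y⟩
    simp only [hΩ₀, hG, Set.mem_union, Set.mem_iUnion, Finset.mem_range, exists_prop,
      Set.mem_ofPred_eq, H, Ω, J, R, habs, Set.mem_prod]
    constructor
    · rintro (⟨hx0, hxa, hy0, hy⟩ | ⟨j, hj, hx⟩)
      · have hfl := Nat.floor_le (div_nonneg hx0.le hε0.le)
        have hfl' := Nat.lt_floor_add_one (x / ε)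
        rw [le_div_iff₀' hε0] at hfl
        rw [div_lt_iff₀' hε0] at hfl'
        refine ⟨⌊x / ε⌋₊, ?_, Or.inl ⟨⟨⟨hfl, by linarith⟩, hx0, hxa⟩, hy0, ?_⟩⟩
        · rw [Nat.floor_lt (by positivity), div_lt_iff₀ hε0, hNε]
          exact hxa
        · rwa [hgγ x ⟨hx0.le, hxa.le⟩]
      · exact ⟨j, hj, Or.inr hx⟩
    · rintro ⟨j, hj, ⟨⟨-, hx0, hxa⟩, hy0, hy⟩ | hx⟩
      · rw [hgγ x ⟨hx0.le, hxa.le⟩] at hy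
        exact Or.inl ⟨hx0, hxa, hy0, hy⟩
      · exact Or.inr ⟨j, hj, hx⟩
  have hJm : ∀ j, MeasurableSet (J j) := fun j => measurableSet_Ico.inter measurableSet_Ioo
  have hHm : ∀ j, MeasurableSet (H j) := fun j =>
    ((measurable_fst (hJm j)).inter ((measurableSet_lt measurable_const measurable_snd).inter
      (measurableSet_lt measurable_snd (hgc.measurable.comp measurable_fst)))).union
      (measurableSet_Ioo.prod measurableSet_Ioo)
  have hdisj : (↑(Finset.range N) : Set ℕ).PairwiseDisjoint H := by
    have hlt : ∀ i j : ℕ, ∀ z, z ∈ H i → z ∈ H j → ¬ i < j := fun i j z hi hj hij => by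
      have h1 := (hHfst i z hi).2
      have h2 := (hHfst j z hj).1
      have h3 : (i : ℝ) + 1 ≤ j := by exact_mod_cast hij
      nlinarith
    intro i _ j _ hij
    refine Set.disjoint_left.2 fun z hi hj => ?_
    rcases lt_or_gt_of_ne hij with h | h
    · exact hlt i j z hi hj h
    · exact hlt j i z hj hi h
  have hbdd : Ω₀ ∪ Gε ⊆ Set.Icc 0 a ×ˢ Set.Icc (-l) M := by
    rw [hset]
    intro z hz
    simp only [Set.mem_iUnion, Finset.mem_range, exists_prop] at hz
    obtain ⟨j, hj, hz | hz⟩ := hz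
    · exact ⟨Set.Ioo_subset_Icc_self hz.1.2, by linarith [hz.2.1], hz.2.2.le.trans (hgM _)⟩
    · exact ⟨Set.Ioo_subset_Icc_self (hJIoo j hj (hRIoo j hz.1)).2, hz.2.1.le,
        hz.2.2.le.trans hM.le⟩
  refine setIntegral_sq_le_of_lintegral_le hu (isCompact_Icc.prod isCompact_Icc) hbdd hK.le ?_
  rw [hset, lintegral_biUnion_finset hdisj fun j _ => hHm j,
    lintegral_biUnion_finset hdisj fun j _ => hHm j, Finset.mul_sum]
  refine Finset.sum_le_sum fun j hj => ?_
  have hjN := Finset.mem_range.1 hj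
  have hzero : ∀ y ∈ R j, u (y, -l) = 0 := fun y hy => hu0 y ⟨j, hj, (habs j y).2 hy⟩
  have hbody := lintegral_body_cell_le hu hgc hm hmg hgM (hJm j) hε0 hl (hJIoo j hjN)
    (fun x hx => Set.Ico_subset_Icc_self hx.1) (by gcongr; linarith) ((hRIoo j).trans (hJIoo j hjN))
    hzero (Ω := Ω j) (H := H j) rfl rfl
  have hrod := (lintegral_rod_le hu hl hzero).trans
    (mul_le_mul_right (lintegral_mono_set (Set.subset_union_right (s := Ω j))) _)
  refine (lintegral_union_le _ _ _).trans ((add_le_add hbody hrod).trans ?_)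
  rw [← add_mul]
  refine mul_le_mul_left ?_ _
  have hwidth : ε * (j + (1 + h) / 2) - ε * (j + (1 - h) / 2) = ε * h := by ring
  rw [hwidth, ← ENNReal.ofReal_add (by positivity) (by positivity)]
  refine ENNReal.ofReal_le_ofReal ?_
  have heq : (ε * (1 / m) + (l + m) * (1 / (ε * h))) * (ε * M)
      = ε * (1 / m) * (ε * M) + (l + m) * M / h := by field_simp
  rw [heq, hKdef]
  gcongr
end
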